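/- Let Q be the Hilbert cube, let F ⊆ Q be a fan with top v, and let (A_n)_{n≥1} be a sequence of arcs in Q such that: v is an end-point of each A_n; A_m ∩ A_n = {v} whenever m ≠ n; A_n ∩ F = {v} for every n; and limsup_n A_n ⊆ F. Then F ∪ ⋃_{n≥1} A_n is a fan. -/

import Mathlib

open Set Filter Topology

/-- A set `A` is an arc if it is homeomorphic to the closed unit interval `[0,1]`. -/
def IsArc {X : Type} [TopologicalSpace X] (A : Set X) : Prop :=
  Nonempty (↥(Set.Icc (0:ℝ) 1) ≃ₜ ↥A)

/-- `x` is an end-point of the arc `A`: some homeomorphism `[0,1] ≃ₜ A` sends `0` to `x`. -/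
def IsArcEndpoint {X : Type} [TopologicalSpace X] (A : Set X) (x : X) : Prop :=
  ∃ e : ↥(Set.Icc (0:ℝ) 1) ≃ₜ ↥A, ((e ⟨0, le_refl 0, zero_le_one⟩ : A) : X) = x

/-- A subcontinuum: a nonempty compact connected subset. -/
def IsSubcontinuum {X : Type} [TopologicalSpace X] (A : Set X) : Prop :=
  IsCompact A ∧ IsConnected A

/-- Every subcontinuum `C` is unicoherent: whenever `C = A ∪ B` with `A`, `B`
subcontinua, the intersection `A ∩ B` is connected. -/
def HereditarilyUnicoherent (X : Type) [TopologicalSpace X] : Prop :=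
  ∀ C A B : Set X, IsSubcontinuum C → IsSubcontinuum A → IsSubcontinuum B →
    A ∪ B = C → IsConnected (A ∩ B)

/-- A dendroid: an arcwise connected, hereditarily unicoherent (metrizable) continuum. -/
def IsDendroid (X : Type) [TopologicalSpace X] : Prop :=
  Nonempty X ∧ CompactSpace X ∧ ConnectedSpace X ∧ TopologicalSpace.MetrizableSpace X ∧
  (∀ x y : X, x ≠ y → ∃ A : Set X, IsArcEndpoint A x ∧ IsArcEndpoint A y) ∧
  HereditarilyUnicoherent X

/-- The set of end-points of a dendroid: points which are end-points of every arc
containing them. -/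
def DendroidEndpoints (X : Type) [TopologicalSpace X] : Set X :=
  {x | ∀ A : Set X, IsArc A → x ∈ A → IsArcEndpoint A x}

/-- The model simple triode `([-1,1] × {0}) ∪ ({0} × [0,1]) ⊆ ℝ²`. -/
def TSet : Set (ℝ × ℝ) := (Set.Icc (-1:ℝ) 1 ×ˢ ({0} : Set ℝ)) ∪ (({0} : Set ℝ) ×ˢ Set.Icc (0:ℝ) 1)

lemma zero_mem_TSet : ((0:ℝ), (0:ℝ)) ∈ TSet :=
  Or.inl ⟨⟨by norm_num, by norm_num⟩, rfl⟩

/-- `T` is a simple triode with top `x`: some homeomorphism from the model triode onto `T`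
sends `(0,0)` to `x`. -/
def IsSimpleTriodeWithTop {X : Type} [TopologicalSpace X] (T : Set X) (x : X) : Prop :=
  ∃ e : ↥TSet ≃ₜ ↥T, ((e ⟨((0:ℝ), (0:ℝ)), zero_mem_TSet⟩ : T) : X) = x

/-- `x` is a ramification point: the top of some simple triode contained in the space. -/
def IsRamificationPoint {X : Type} [TopologicalSpace X] (x : X) : Prop :=
  ∃ T : Set X, IsSimpleTriodeWithTop T x

/-- A fan: a dendroid with at most one ramification point. -/
def IsFan (X : Type) [TopologicalSpace X] : Prop :=
  IsDendroid X ∧ ∀ x y : X, IsRamificationPoint x → IsRamificationPoint y → x = y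

/-- `v` is the top of the fan: its ramification point if one exists, otherwise an end-point. -/
def IsFanTop {X : Type} [TopologicalSpace X] (v : X) : Prop :=
  IsRamificationPoint v ∨
    ((∀ x : X, ¬ IsRamificationPoint x) ∧ v ∈ DendroidEndpoints X)

/-- A Lelek-like fan: a fan whose set of end-points is dense. -/
def IsLelekLikeFan (X : Type) [TopologicalSpace X] : Prop :=
  IsFan X ∧ Dense (DendroidEndpoints X)

/-- The Hilbert cube `[0,1]^ℕ`. -/
abbrev HilbertCube : Type := ℕ → ↥(Set.Icc (0:ℝ) 1)

/-- Any two intersecting subcontinua contained in `S` have preconnected intersection. -/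
def UnicoherentOn {X : Type} [TopologicalSpace X] (S : Set X) : Prop :=
  ∀ A B : Set X, A ⊆ S → B ⊆ S → IsCompact A → IsCompact B → IsPreconnected A →
    IsPreconnected B → (A ∩ B).Nonempty → IsPreconnected (A ∩ B)

/-- The points `x` and `y` are joined by an injective path in `S`. -/
def ArcJoinedIn {X : Type} [TopologicalSpace X] (S : Set X) (x y : X) : Prop :=
  ∃ γ : Path x y, Function.Injective γ ∧ ∀ t, γ t ∈ S

section Unicoherence

variable {X Y : Type} [TopologicalSpace X] [TopologicalSpace Y]

lemma HereditarilyUnicoherent.unicoherentOn_univ (h : HereditarilyUnicoherent X) :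
    UnicoherentOn (univ : Set X) := by
  intro A B _ _ hA hB hA' hB' hne
  have hAc : IsConnected A := ⟨hne.left, hA'⟩
  have hBc : IsConnected B := ⟨hne.right, hB'⟩
  exact (h (A ∪ B) A B ⟨hA.union hB, IsConnected.union hne hAc hBc⟩
    ⟨hA, hAc⟩ ⟨hB, hBc⟩ rfl).isPreconnected

lemma UnicoherentOn.hereditarilyUnicoherent [T2Space X] (h : UnicoherentOn (univ : Set X)) :
    HereditarilyUnicoherent X := by
  rintro C A B hC hA hB rfl
  have hne : (A ∩ B).Nonempty := by
    obtain ⟨x, _, hx⟩ := isPreconnected_closed_iff.1 hC.2.isPreconnected A B hA.1.isClosed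
      hB.1.isClosed subset_rfl (hA.2.nonempty.mono fun x hx => ⟨Or.inl hx, hx⟩)
      (hB.2.nonempty.mono fun x hx => ⟨Or.inr hx, hx⟩)
    exact ⟨x, hx⟩
  exact ⟨hne, h A B (subset_univ _) (subset_univ _) hA.1 hB.1 hA.2.isPreconnected
    hB.2.isPreconnected hne⟩

lemma UnicoherentOn.range {f : X → Y} (hf : IsEmbedding f) (h : UnicoherentOn (univ : Set X)) :
    UnicoherentOn (Set.range f) := by
  intro A B hAs hBs hA hB hA' hB' hne
  obtain ⟨A, rfl⟩ := subset_range_iff_exists_image_eq.1 hAs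
  obtain ⟨B, rfl⟩ := subset_range_iff_exists_image_eq.1 hBs
  rw [← image_inter hf.injective] at hne ⊢
  rw [hf.isInducing.isPreconnected_image] at hA' hB' ⊢
  rw [← hf.isInducing.isCompact_iff] at hA hB
  exact h A B (subset_univ _) (subset_univ _) hA hB hA' hB' (image_nonempty.1 hne)

lemma UnicoherentOn.of_range {f : X → Y} (hf : IsEmbedding f) (h : UnicoherentOn (Set.range f)) :
    UnicoherentOn (univ : Set X) := by
  intro A B _ _ hA hB hA' hB' hne
  rw [← hf.isInducing.isPreconnected_image, image_inter hf.injective]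
  refine h _ _ (image_subset_range _ _) (image_subset_range _ _) (hA.image hf.continuous)
    (hB.image hf.continuous) (hA'.image _ hf.continuous.continuousOn)
    (hB'.image _ hf.continuous.continuousOn) ?_
  rw [← image_inter hf.injective]
  exact hne.image f

lemma unicoherentOn_real : UnicoherentOn (univ : Set ℝ) := by
  intro A B _ _ _ _ hA hB _
  have := hA.ordConnected
  have := hB.ordConnected
  exact (OrdConnected.inter ‹A.OrdConnected› ‹B.OrdConnected›).isPreconnected

lemma UnicoherentOn.mono {S T : Set X} (h : UnicoherentOn T) (hST : S ⊆ T) :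
    UnicoherentOn S :=
  fun A B hA hB => h A B (hA.trans hST) (hB.trans hST)

lemma IsArc.unicoherentOn {A : Set X} (hA : IsArc A) : UnicoherentOn A := by
  obtain ⟨e⟩ := hA
  have h1 : UnicoherentOn (univ : Set (Icc (0 : ℝ) 1)) :=
    (unicoherentOn_real.mono (subset_univ _)).of_range IsEmbedding.subtypeVal
  have h2 := h1.range (IsEmbedding.subtypeVal.comp e.isEmbedding)
  rwa [e.surjective.range_comp, Subtype.range_coe] at h2

lemma IsArc.isCompact {A : Set X} (hA : IsArc A) : IsCompact A := by
  obtain ⟨e⟩ := hA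
  have := e.compactSpace
  exact isCompact_iff_compactSpace.2 this

lemma IsPreconnected.inter_of_subset_union {K P R : Set X} {v : X} (hK : IsPreconnected K)
    (hP : IsClosed P) (hR : IsClosed R) (hPR : P ∩ R = {v}) (hsub : K ⊆ P ∪ R) :
    IsPreconnected (K ∩ P) := by
  have hvPR : v ∈ P ∩ R := hPR ▸ mem_singleton v
  by_cases hKR : (K ∩ R).Nonempty
  swap
  · have : K ∩ P = K := inter_eq_left.2 fun x hx =>
      (hsub hx).resolve_right fun h => hKR ⟨x, hx, h⟩
    rwa [this]
  by_cases hKP : (K ∩ P).Nonempty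
  swap
  · rw [not_nonempty_iff_eq_empty.1 hKP]
    exact isPreconnected_empty
  have hvK : v ∈ K := by
    obtain ⟨x, hx, hx'⟩ := isPreconnected_closed_iff.1 hK P R hP hR hsub hKP hKR
    rw [hPR] at hx'
    rwa [← mem_singleton_iff.1 hx']
  have key : ∀ t t' : Set X, IsClosed t → IsClosed t' → K ∩ P ⊆ t ∪ t' →
      ((K ∩ P) ∩ t').Nonempty → v ∈ t → ((K ∩ P) ∩ (t ∩ t')).Nonempty := by
    intro t t' ht ht' hs ⟨y, hy, hyt⟩ hvt
    obtain ⟨x, hxK, ⟨hxt', hxP⟩, hx⟩ := isPreconnected_closed_iff.1 hK (t' ∩ P) (t ∩ P ∪ R)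
      (ht'.inter hP) ((ht.inter hP).union hR)
      (by
        intro x hx
        rcases hsub hx with h | h
        · rcases hs ⟨hx, h⟩ with h' | h'
          · exact Or.inr (Or.inl ⟨h', h⟩)
          · exact Or.inl ⟨h', h⟩
        · exact Or.inr (Or.inr h))
      ⟨y, hy.1, hyt, hy.2⟩ ⟨v, hvK, Or.inr hvPR.2⟩
    rcases hx with hx | hx
    · exact ⟨x, ⟨hxK, hxP⟩, hx.1, hxt'⟩
    · have hxv : x ∈ P ∩ R := ⟨hxP, hx⟩
      rw [hPR, mem_singleton_iff] at hxv
      subst hxv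
      exact ⟨x, ⟨hxK, hxP⟩, hvt, hxt'⟩
  rw [isPreconnected_closed_iff]
  intro t t' ht ht' hs hn hn'
  rcases hs ⟨hvK, hvPR.1⟩ with h | h
  · exact key t t' ht ht' hs hn' h
  · rw [inter_comm t t']
    exact key t' t ht' ht (union_comm t t' ▸ hs) hn h

end Unicoherence

section Arcs

variable {X Y : Type} [TopologicalSpace X] [TopologicalSpace Y]

lemma ArcJoinedIn.symm {S : Set X} {x y : X} (h : ArcJoinedIn S x y) : ArcJoinedIn S y x := by
  obtain ⟨γ, hγ, hS⟩ := h
  refine ⟨γ.symm, ?_, fun t => by simpa using hS _⟩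
  intro s t hst
  simpa using hγ hst

lemma ArcJoinedIn.mono {S T : Set X} {x y : X} (h : ArcJoinedIn S x y) (hST : S ⊆ T) :
    ArcJoinedIn T x y := by
  obtain ⟨γ, hγ, hS⟩ := h
  exact ⟨γ, hγ, fun t => hST (hS t)⟩

lemma ArcJoinedIn.map {S : Set X} {T : Set Y} {x y : X} (h : ArcJoinedIn S x y) {f : X → Y}
    (hf : Continuous f) (hinj : Function.Injective f) (hST : MapsTo f S T) :
    ArcJoinedIn T (f x) (f y) := by
  obtain ⟨γ, hγ, hS⟩ := h
  exact ⟨γ.map hf, hinj.comp hγ, fun t => hST (hS t)⟩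

lemma ArcJoinedIn.trans {P R : Set X} {x v y : X} (h : ArcJoinedIn P x v)
    (h' : ArcJoinedIn R v y) (hPR : P ∩ R ⊆ {v}) : ArcJoinedIn (P ∪ R) x y := by
  obtain ⟨γ, hγ, hP⟩ := h
  obtain ⟨δ, hδ, hR⟩ := h'
  have mixed : ∀ a b : unitInterval, γ a = δ b → (a : ℝ) = 1 ∧ (b : ℝ) = 0 := by
    intro a b hab
    have hv : γ a = v := hPR ⟨hP a, hab ▸ hR b⟩
    have ha : a = 1 := hγ (by rw [hv, γ.target])
    have hb : b = 0 := hδ (by rw [← hab, hv, δ.source])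
    simp [ha, hb]
  refine ⟨γ.trans δ, ?_, ?_⟩
  · intro s t hst
    rw [Path.trans_apply, Path.trans_apply] at hst
    apply Subtype.ext
    split_ifs at hst with h1 h2 h2
    · have := congrArg Subtype.val (hγ hst)
      simp only at this
      linarith
    · have := mixed _ _ hst
      simp only at this
      linarith
    · have := mixed _ _ hst.symm
      simp only at this
      linarith
    · have := congrArg Subtype.val (hδ hst)
      simp only at this
      linarith
  · intro t
    rw [Path.trans_apply]
    split_ifs
    · exact Or.inl (hP _)
    · exact Or.inr (hR _)

lemma arcJoinedIn_unitInterval {s t : unitInterval} (hst : s ≠ t) :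
    ArcJoinedIn (univ : Set unitInterval) s t := by
  have hmem : ∀ r : unitInterval, (1 - (r : ℝ)) * s + r * t ∈ Icc (0 : ℝ) 1 := by
    intro r
    have := (convex_Icc (0 : ℝ) 1) s.2 t.2 (a := 1 - (r : ℝ)) (b := r)
      (by linarith [r.2.2]) r.2.1 (by ring)
    simpa using this
  refine ⟨⟨⟨fun r => ⟨(1 - (r : ℝ)) * s + r * t, hmem r⟩, by fun_prop⟩, ?_, ?_⟩, ?_,
    fun _ => mem_univ _⟩
  · simp
  · simp
  · intro a b hab
    have h1 : (1 - (a : ℝ)) * s + a * t = (1 - (b : ℝ)) * s + b * t := congrArg Subtype.val hab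
    have h2 : ((a : ℝ) - b) * (t - s) = 0 := by linear_combination h1
    rcases mul_eq_zero.1 h2 with h | h
    · exact Subtype.ext (by linarith)
    · exact absurd (Subtype.ext (by linarith)) hst

lemma IsArc.arcJoinedIn {A : Set X} (hA : IsArc A) {x y : X} (hx : x ∈ A) (hy : y ∈ A)
    (hxy : x ≠ y) : ArcJoinedIn A x y := by
  obtain ⟨e⟩ := hA
  have hne : e.symm ⟨x, hx⟩ ≠ e.symm ⟨y, hy⟩ := fun h =>
    hxy (congrArg Subtype.val (e.symm.injective h))
  have := (arcJoinedIn_unitInterval hne).map (f := fun r => (e r : X)) (T := A)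
    (continuous_subtype_val.comp e.continuous) (Subtype.val_injective.comp e.injective)
    (fun r _ => (e r).2)
  simpa using this

lemma IsArcEndpoint.isArc {A : Set X} {x : X} (h : IsArcEndpoint A x) : IsArc A :=
  let ⟨e, _⟩ := h
  ⟨e⟩

lemma IsArcEndpoint.mem {A : Set X} {x : X} (h : IsArcEndpoint A x) : x ∈ A := by
  obtain ⟨e, rfl⟩ := h
  exact Subtype.prop _

lemma IsArcEndpoint.range_path [T2Space X] {x y : X} (γ : Path x y)
    (hγ : Function.Injective γ) : IsArcEndpoint (range γ) x :=
  ⟨(γ.continuous.isClosedEmbedding hγ).isEmbedding.toHomeomorph, γ.source⟩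

lemma ArcJoinedIn.exists_arc [T2Space X] {S : Set X} {x y : X} (h : ArcJoinedIn S x y) :
    ∃ A : Set X, IsArcEndpoint A x ∧ IsArcEndpoint A y := by
  obtain ⟨γ, hγ, -⟩ := h
  refine ⟨range γ, .range_path γ hγ, ?_⟩
  rw [← Path.symm_range]
  refine .range_path γ.symm ?_
  intro s t hst
  simpa using hγ hst

end Arcs

section Triodes

lemma smul_mem_TSet {p : ℝ × ℝ} (hp : p ∈ TSet) {ε : ℝ} (h0 : 0 ≤ ε) (h1 : ε ≤ 1) :
    ε • p ∈ TSet := by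
  obtain ⟨a, b⟩ := p
  rcases hp with ⟨⟨ha, ha'⟩, hb⟩ | ⟨ha, hb, hb'⟩
  · left
    simp only [mem_singleton_iff] at hb ha ha'
    refine ⟨⟨?_, ?_⟩, ?_⟩ <;> simp only [Prod.smul_mk, smul_eq_mul, mem_singleton_iff, hb] <;>
      nlinarith
  · right
    simp only [mem_singleton_iff] at ha hb hb'
    refine ⟨?_, ?_, ?_⟩ <;> simp only [Prod.smul_mk, smul_eq_mul, mem_singleton_iff, ha] <;>
      nlinarith

lemma norm_le_one_of_mem_TSet {p : ℝ × ℝ} (hp : p ∈ TSet) : ‖p‖ ≤ 1 := by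
  obtain ⟨a, b⟩ := p
  rw [Prod.norm_def, max_le_iff, Real.norm_eq_abs, Real.norm_eq_abs, abs_le, abs_le]
  rcases hp with ⟨⟨ha, ha'⟩, hb⟩ | ⟨ha, hb, hb'⟩
  · simp only [mem_singleton_iff] at hb ha ha'
    refine ⟨⟨?_, ?_⟩, ?_, ?_⟩ <;> simp only <;> linarith
  · simp only [mem_singleton_iff] at ha hb hb'
    refine ⟨⟨?_, ?_⟩, ?_, ?_⟩ <;> simp only <;> linarith

lemma isPreconnected_TSet : IsPreconnected TSet := by
  have h : StarConvex ℝ (0 : ℝ × ℝ) TSet :=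
    starConvex_zero_iff.2 fun _ hp _ h0 h1 => smul_mem_TSet hp h0 h1
  exact (h.isPathConnected zero_mem_TSet).isConnected.isPreconnected

lemma isCompact_TSet : IsCompact TSet :=
  (isCompact_Icc.prod isCompact_singleton).union (isCompact_singleton.prod isCompact_Icc)

lemma isRamificationPoint_of_injective {X : Type} [TopologicalSpace X] [T2Space X]
    {φ : TSet → X} (hφ : Continuous φ) (hinj : Function.Injective φ) :
    IsRamificationPoint (φ ⟨((0 : ℝ), (0 : ℝ)), zero_mem_TSet⟩) := by
  have := isCompact_iff_compactSpace.1 isCompact_TSet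
  exact ⟨range φ, (hφ.isClosedEmbedding hinj).isEmbedding.toHomeomorph, rfl⟩

lemma IsRamificationPoint.exists_avoiding {X : Type} [TopologicalSpace X] {x v : X}
    (hx : IsRamificationPoint x) (hxv : x ≠ v) :
    ∃ φ : TSet → X, Continuous φ ∧ Function.Injective φ ∧
      φ ⟨((0 : ℝ), (0 : ℝ)), zero_mem_TSet⟩ = x ∧ ∀ p, φ p ≠ v := by
  obtain ⟨T, e, he⟩ := hx
  have hinj : Function.Injective fun p => (e p : X) := Subtype.val_injective.comp e.injective
  obtain ⟨ε, h0, h1, hε⟩ : ∃ ε : ℝ, 0 < ε ∧ ε ≤ 1 ∧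
      ∀ p : TSet, (e p : X) = v → ε < ‖(p : ℝ × ℝ)‖ := by
    by_cases h : ∃ q, (e q : X) = v
    · obtain ⟨q, hq⟩ := h
      have hq0 : 0 < ‖(q : ℝ × ℝ)‖ := by
        rw [norm_pos_iff]
        intro h
        have : q = ⟨((0 : ℝ), (0 : ℝ)), zero_mem_TSet⟩ := Subtype.ext h
        rw [this, he] at hq
        exact hxv hq
      refine ⟨‖(q : ℝ × ℝ)‖ / 2, by linarith, by linarith [norm_le_one_of_mem_TSet q.2], ?_⟩
      intro p hp
      have : p = q := hinj (hp.trans hq.symm)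
      rw [this]
      linarith
    · exact ⟨1, one_pos, le_rfl, fun p hp => absurd ⟨p, hp⟩ h⟩
  refine ⟨fun p => e ⟨ε • (p : ℝ × ℝ), smul_mem_TSet p.2 h0.le h1⟩, ?_, ?_, ?_, ?_⟩
  · fun_prop
  · intro p q hpq
    have := congrArg Subtype.val (hinj hpq)
    exact Subtype.ext (smul_right_injective _ h0.ne' this)
  · rw [← he]
    simp
  · intro p hp
    have h2 := hε _ hp
    simp only [norm_smul, Real.norm_eq_abs, abs_of_pos h0] at h2
    nlinarith [norm_le_one_of_mem_TSet p.2]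

lemma exists_common_value_of_lt {f g : ℝ → ℝ} (hf : ContinuousOn f (Icc 0 1))
    (hg : ContinuousOn g (Icc 0 1)) (h0 : f 0 = g 0) (hf1 : f 0 < f 1) (hg1 : g 0 < g 1) :
    ∃ s ∈ Ioc (0 : ℝ) 1, ∃ t ∈ Ioc (0 : ℝ) 1, f s = g t := by
  have hd : f 0 < min (f 1) (g 1) := lt_min hf1 (h0 ▸ hg1)
  obtain ⟨s, hs, hs'⟩ := intermediate_value_Icc zero_le_one hf ⟨hd.le, min_le_left _ _⟩
  obtain ⟨t, ht, ht'⟩ := intermediate_value_Icc zero_le_one hg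
    ⟨h0 ▸ hd.le, min_le_right (f 1) (g 1)⟩
  refine ⟨s, ⟨lt_of_le_of_ne hs.1 ?_, hs.2⟩, t, ⟨lt_of_le_of_ne ht.1 ?_, ht.2⟩,
    hs'.trans ht'.symm⟩
  · rintro rfl
    exact hd.ne hs'
  · rintro rfl
    exact hd.ne (h0.trans ht')

lemma not_injective_TSet_real (φ : TSet → ℝ) (hφ : Continuous φ) : ¬ Function.Injective φ := by
  intro hinj
  let g : ℝ × ℝ → ℝ := Function.extend Subtype.val φ 0
  have hg : ∀ p : TSet, g p = φ p := fun p => Subtype.val_injective.extend_apply φ 0 p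
  have hgc : ContinuousOn g TSet := by
    rw [continuousOn_iff_continuous_domRestrict]
    convert hφ using 1
    exact funext hg
  have hgi : InjOn g TSet := fun p hp q hq h => by
    have : φ ⟨p, hp⟩ = φ ⟨q, hq⟩ := by rw [← hg, ← hg]; exact h
    exact congrArg Subtype.val (hinj this)
  have leg : ∀ u : ℝ × ℝ, u ∈ TSet → u ≠ 0 → (ContinuousOn (fun t : ℝ => g (t • u)) (Icc 0 1)) ∧
      g ((0 : ℝ) • u) ≠ g ((1 : ℝ) • u) := by
    intro u hu hu0
    refine ⟨hgc.comp (by fun_prop) fun t ht => smul_mem_TSet hu ht.1 ht.2, fun h => hu0 ?_⟩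
    have := hgi (smul_mem_TSet hu le_rfl zero_le_one) (smul_mem_TSet hu zero_le_one le_rfl) h
    simpa using this.symm
  have pair : ∀ u w : ℝ × ℝ, u ∈ TSet → w ∈ TSet → u ≠ 0 → w ≠ 0 →
      (∀ s ∈ Ioc (0 : ℝ) 1, ∀ t ∈ Ioc (0 : ℝ) 1, s • u ≠ t • w) →
      (g 0 < g u ↔ ¬ g 0 < g w) := by
    intro u w hu hw hu0 hw0 hne
    obtain ⟨cu, nu⟩ := leg u hu hu0
    obtain ⟨cw, nw⟩ := leg w hw hw0
    simp only [zero_smul, one_smul] at nu nw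
    have key : ¬ ∃ s ∈ Ioc (0 : ℝ) 1, ∃ t ∈ Ioc (0 : ℝ) 1, g (s • u) = g (t • w) := by
      rintro ⟨s, hs, t, ht, h⟩
      exact hne s hs t ht (hgi (smul_mem_TSet hu hs.1.le hs.2) (smul_mem_TSet hw ht.1.le ht.2) h)
    constructor
    · intro h1 h2
      exact key (exists_common_value_of_lt cu cw (by simp) (by simpa using h1) (by simpa using h2))
    · intro h2
      by_contra h1
      have h1' := lt_of_le_of_ne (not_lt.1 h1) nu.symm
      have h2' := lt_of_le_of_ne (not_lt.1 h2) nw.symm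
      obtain ⟨s, hs, t, ht, h⟩ := exists_common_value_of_lt cu.neg cw.neg (by simp)
        (by simpa using h1') (by simpa using h2')
      exact key ⟨s, hs, t, ht, neg_injective h⟩
  have m1 : ((1 : ℝ), (0 : ℝ)) ∈ TSet := Or.inl ⟨by norm_num, rfl⟩
  have m2 : ((-1 : ℝ), (0 : ℝ)) ∈ TSet := Or.inl ⟨by norm_num, rfl⟩
  have m3 : ((0 : ℝ), (1 : ℝ)) ∈ TSet := Or.inr ⟨rfl, by norm_num⟩
  have h12 := pair _ _ m1 m2 (by simp) (by simp) (by
    intro s hs t ht h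
    have := congrArg Prod.fst h
    simp only [Prod.smul_mk, smul_eq_mul] at this
    linarith [hs.1, ht.1])
  have h13 := pair _ _ m1 m3 (by simp) (by simp) (by
    intro s hs t ht h
    have := congrArg Prod.fst h
    simp only [Prod.smul_mk, smul_eq_mul] at this
    linarith [hs.1, ht.1])
  have h23 := pair _ _ m2 m3 (by simp) (by simp) (by
    intro s hs t ht h
    have := congrArg Prod.fst h
    simp only [Prod.smul_mk, smul_eq_mul] at this
    linarith [hs.1, ht.1])
  tauto

end Triodes

section Attaching

variable {X : Type} {F : Set X} {A : ℕ → Set X} {v : X}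

lemma inter_union_biUnion_eq (hv : v ∈ F) (hdisj : ∀ m n, m ≠ n → A m ∩ A n = {v})
    (hAF : ∀ n, A n ∩ F = {v}) (n : ℕ) : A n ∩ (F ∪ ⋃ m ∈ ({n}ᶜ : Set ℕ), A m) = {v} := by
  apply Subset.antisymm
  · rintro x ⟨hx, hx' | hx'⟩
    · exact hAF n ▸ ⟨hx, hx'⟩
    · simp only [mem_iUnion, exists_prop] at hx'
      obtain ⟨m, hm, hxm⟩ := hx'
      rw [← hdisj n m (Ne.symm hm)]
      exact ⟨hx, hxm⟩
  · rintro x rfl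
    have : x ∈ A n ∩ F := hAF n ▸ mem_singleton x
    exact ⟨this.1, Or.inl hv⟩

lemma union_iUnion_subset (n : ℕ) :
    F ∪ ⋃ m, A m ⊆ A n ∪ (F ∪ ⋃ m ∈ ({n}ᶜ : Set ℕ), A m) := by
  rintro x (hx | hx)
  · exact Or.inr (Or.inl hx)
  · obtain ⟨m, hm⟩ := mem_iUnion.1 hx
    by_cases h : m = n
    · exact Or.inl (h ▸ hm)
    · exact Or.inr (Or.inr (mem_biUnion (show m ∈ ({n}ᶜ : Set ℕ) from h) hm))

variable [TopologicalSpace X]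

lemma arcJoinedIn_union_iUnion (hv : v ∈ F) (hdisj : ∀ m n, m ≠ n → A m ∩ A n = {v})
    (hAF : ∀ n, A n ∩ F = {v})
    (hFj : ∀ x ∈ F, ∀ y ∈ F, x ≠ y → ArcJoinedIn F x y)
    (hAj : ∀ n, ∀ x ∈ A n, ∀ y ∈ A n, x ≠ y → ArcJoinedIn (A n) x y)
    {x y : X} (hx : x ∈ F ∪ ⋃ n, A n) (hy : y ∈ F ∪ ⋃ n, A n) (hxy : x ≠ y) :
    ArcJoinedIn (F ∪ ⋃ n, A n) x y := by
  have hvA : ∀ n, v ∈ A n := fun n => (hAF n ▸ mem_singleton v : v ∈ A n ∩ F).1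
  have hAs : ∀ n, A n ⊆ F ∪ ⋃ n, A n := fun n => (subset_iUnion A n).trans subset_union_right
  have attached : ∀ n, ∀ x ∈ A n, ∀ y ∈ F, x ≠ y → ArcJoinedIn (F ∪ ⋃ n, A n) x y := by
    intro n x hx y hy hxy
    by_cases hxv : x = v
    · subst hxv
      exact (hFj x hv y hy hxy).mono subset_union_left
    by_cases hyv : y = v
    · subst hyv
      exact (hAj n x hx y (hvA n) hxy).mono (hAs n)
    · exact ((hAj n x hx v (hvA n) hxv).trans (hFj v hv y hy (Ne.symm hyv)) (hAF n).subset).mono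
        (union_subset (hAs n) subset_union_left)
  rcases hx with hx | hx <;> rcases hy with hy | hy
  · exact (hFj x hx y hy hxy).mono subset_union_left
  · obtain ⟨n, hn⟩ := mem_iUnion.1 hy
    exact (attached n y hn x hx hxy.symm).symm
  · obtain ⟨n, hn⟩ := mem_iUnion.1 hx
    exact attached n x hn y hy hxy
  · obtain ⟨m, hm⟩ := mem_iUnion.1 hx
    obtain ⟨n, hn⟩ := mem_iUnion.1 hy
    by_cases hxv : x = v
    · exact (attached n y hn x (hxv ▸ hv) hxy.symm).symm
    by_cases hyv : y = v
    · exact attached m x hm y (hyv ▸ hv) hxy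
    by_cases hmn : m = n
    · subst hmn
      exact (hAj m x hm y hn hxy).mono (hAs m)
    · exact ((hAj m x hm v (hvA m) hxv).trans (hAj n v (hvA n) y hn (Ne.symm hyv))
        (hdisj m n hmn).subset).mono (union_subset (hAs m) (hAs n))

lemma isClosed_union_biUnion (hF : IsClosed F)
    (hA : ∀ n, IsClosed (A n))
    (hlim : {x : X | ∀ U ∈ 𝓝 x, ∀ N : ℕ, ∃ n, N ≤ n ∧ (U ∩ A n).Nonempty} ⊆ F) (J : Set ℕ) :
    IsClosed (F ∪ ⋃ n ∈ J, A n) := by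
  refine isClosed_of_closure_subset fun x hx => ?_
  by_cases hxF : x ∈ F
  · exact Or.inl hxF
  have hx' : ¬ ∀ U ∈ 𝓝 x, ∀ N : ℕ, ∃ n, N ≤ n ∧ (U ∩ A n).Nonempty := fun h => hxF (hlim h)
  push Not at hx'
  obtain ⟨U, hU, N, hN⟩ := hx'
  by_contra hxJ
  have hC : IsClosed (F ∪ ⋃ n ∈ J ∩ Iio N, A n) :=
    hF.union (((finite_Iio N).inter_of_right J).isClosed_biUnion fun n _ => hA n)
  have hxC : x ∉ F ∪ ⋃ n ∈ J ∩ Iio N, A n := fun h =>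
    hxJ (union_subset_union_right F (biUnion_subset_biUnion_left inter_subset_left) h)
  obtain ⟨y, ⟨hyU, hyC⟩, hy⟩ :=
    mem_closure_iff_nhds.1 hx _ (inter_mem hU (hC.isOpen_compl.mem_nhds hxC))
  rcases hy with hy | hy
  · exact hyC (Or.inl hy)
  · simp only [mem_iUnion, exists_prop] at hy
    obtain ⟨n, hnJ, hn⟩ := hy
    rcases lt_or_ge n N with h | h
    · exact hyC (Or.inr (mem_biUnion (show n ∈ J ∩ Iio N from ⟨hnJ, h⟩) hn))
    · exact (hN n h).subset ⟨hyU, hn⟩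

lemma IsCompact.exists_forall_disjoint {L : Set X} (hL : IsCompact L)
    (hlim : {x : X | ∀ U ∈ 𝓝 x, ∀ N : ℕ, ∃ n, N ≤ n ∧ (U ∩ A n).Nonempty} ⊆ F)
    (hLF : Disjoint L F) : ∃ N, ∀ n, N ≤ n → Disjoint L (A n) := by
  refine hL.induction_on (p := fun s => ∃ N, ∀ n, N ≤ n → Disjoint s (A n)) ⟨0, by simp⟩ ?_ ?_ ?_
  · rintro s t hst ⟨N, hN⟩
    exact ⟨N, fun n hn => (hN n hn).mono_left hst⟩
  · rintro s t ⟨N, hN⟩ ⟨M, hM⟩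
    exact ⟨max N M, fun n hn => disjoint_union_left.2
      ⟨hN n (le_of_max_le_left hn), hM n (le_of_max_le_right hn)⟩⟩
  · intro x hx
    have hx' : ¬ ∀ U ∈ 𝓝 x, ∀ N : ℕ, ∃ n, N ≤ n ∧ (U ∩ A n).Nonempty := fun h =>
      disjoint_left.1 hLF hx (hlim h)
    push Not at hx'
    obtain ⟨U, hU, N, hN⟩ := hx'
    exact ⟨U, mem_nhdsWithin_of_mem_nhds hU, N,
      fun n hn => disjoint_iff_inter_eq_empty.2 (hN n hn)⟩

lemma IsPreconnected.inter_attached (hv : v ∈ F) (hF : IsClosed F) (hA : ∀ n, IsClosed (A n))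
    (hdisj : ∀ m n, m ≠ n → A m ∩ A n = {v}) (hAF : ∀ n, A n ∩ F = {v})
    (hlim : {x : X | ∀ U ∈ 𝓝 x, ∀ N : ℕ, ∃ n, N ≤ n ∧ (U ∩ A n).Nonempty} ⊆ F)
    {K : Set X} (hK : IsPreconnected K) (hsub : K ⊆ F ∪ ⋃ n, A n) (n : ℕ) :
    IsPreconnected (K ∩ A n) :=
  hK.inter_of_subset_union (hA n) (isClosed_union_biUnion hF hA hlim _)
    (inter_union_biUnion_eq hv hdisj hAF n) (hsub.trans (union_iUnion_subset n))

lemma IsPreconnected.subset_piece (hv : v ∈ F) (hF : IsClosed F) (hA : ∀ n, IsClosed (A n))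
    (hdisj : ∀ m n, m ≠ n → A m ∩ A n = {v}) (hAF : ∀ n, A n ∩ F = {v})
    (hlim : {x : X | ∀ U ∈ 𝓝 x, ∀ N : ℕ, ∃ n, N ≤ n ∧ (U ∩ A n).Nonempty} ⊆ F)
    {K : Set X} (hK : IsPreconnected K) (hsub : K ⊆ F ∪ ⋃ n, A n) (hvK : v ∉ K) :
    K ⊆ F ∨ ∃ n, K ⊆ A n := by
  by_contra! h
  obtain ⟨hKF, hKA⟩ := h
  obtain ⟨x, hxK, hxF⟩ := not_subset.1 hKF
  obtain ⟨n, hn⟩ := mem_iUnion.1 ((hsub hxK).resolve_left hxF)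
  obtain ⟨y, hyK, hyA⟩ := not_subset.1 (hKA n)
  have hcov := hsub.trans (union_iUnion_subset n)
  obtain ⟨z, hzK, hz⟩ := isPreconnected_closed_iff.1 hK _ _ (hA n)
    (isClosed_union_biUnion hF hA hlim _) hcov ⟨x, hxK, hn⟩
    ⟨y, hyK, (hcov hyK).resolve_left hyA⟩
  rw [inter_union_biUnion_eq hv hdisj hAF n, mem_singleton_iff] at hz
  exact hvK (hz ▸ hzK)

lemma IsPreconnected.inter_base [T2Space X] (hv : v ∈ F) (hF : IsClosed F)
    (hA : ∀ n, IsClosed (A n))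
    (hdisj : ∀ m n, m ≠ n → A m ∩ A n = {v}) (hAF : ∀ n, A n ∩ F = {v})
    (hlim : {x : X | ∀ U ∈ 𝓝 x, ∀ N : ℕ, ∃ n, N ≤ n ∧ (U ∩ A n).Nonempty} ⊆ F)
    {K : Set X} (hKc : IsCompact K) (hK : IsPreconnected K) (hsub : K ⊆ F ∪ ⋃ n, A n) :
    IsPreconnected (K ∩ F) := by
  have hvA : ∀ n, v ∈ A n := fun n => (hAF n ▸ mem_singleton v : v ∈ A n ∩ F).1
  by_cases hvK : v ∈ K
  swap
  · rcases hK.subset_piece hv hF hA hdisj hAF hlim hsub hvK with h | ⟨n, h⟩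
    · rwa [inter_eq_left.2 h]
    · have : K ∩ F ⊆ {v} := hAF n ▸ inter_subset_inter_left F h
      exact (subsingleton_singleton.anti this).isPreconnected
  have key : ∀ t t' : Set X, IsClosed t → IsClosed t' → K ∩ F ⊆ t ∪ t' →
      ((K ∩ F) ∩ t').Nonempty → v ∈ t → ((K ∩ F) ∩ (t ∩ t')).Nonempty := by
    intro t t' ht ht' hs ⟨y, hy, hyt⟩ hvt
    by_contra hemp
    have hKF : IsCompact (K ∩ F) := hKc.inter_right hF
    have hdis : Disjoint (K ∩ F ∩ t) (K ∩ F ∩ t') := disjoint_left.2 fun x hx hx' =>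
      hemp ⟨x, hx.1, hx.2, hx'.2⟩
    obtain ⟨U, W, hU, hW, hPU, hRW, hUW⟩ :=
      SeparatedNhds.of_isCompact_isCompact (hKF.inter_right ht)
        (hKF.inter_right ht') hdis
    obtain ⟨N, hN⟩ := (hKc.diff (hU.union hW)).exists_forall_disjoint hlim
      (disjoint_left.2 fun x hx hxF => hx.2 <| by
        rcases hs ⟨hx.1, hxF⟩ with h | h
        · exact Or.inl (hPU ⟨⟨hx.1, hxF⟩, h⟩)
        · exact Or.inr (hRW ⟨⟨hx.1, hxF⟩, h⟩))
    have hNU : ∀ n, N ≤ n → K ∩ A n ⊆ U := fun n hn =>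
      (hK.inter_attached hv hF hA hdisj hAF hlim hsub n).subset_left_of_subset_union hU hW hUW
        (fun x hx => by_contra fun h => disjoint_left.1 (hN n hn) ⟨hx.1, h⟩ hx.2)
        ⟨v, ⟨hvK, hvA n⟩, hPU ⟨⟨hvK, hv⟩, hvt⟩⟩
    obtain ⟨x, hxK, hxR, hx⟩ := isPreconnected_closed_iff.1 hK (K ∩ F ∩ t')
      (Wᶜ ∪ ⋃ n ∈ Iio N, A n) (hKF.inter_right ht').isClosed
      (hW.isClosed_compl.union ((finite_Iio N).isClosed_biUnion fun n _ => hA n))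
      (by
        intro x hx
        rcases hsub hx with h | h
        · rcases hs ⟨hx, h⟩ with h' | h'
          · exact Or.inr (Or.inl (disjoint_left.1 hUW (hPU ⟨⟨hx, h⟩, h'⟩)))
          · exact Or.inl ⟨⟨hx, h⟩, h'⟩
        · obtain ⟨n, hn⟩ := mem_iUnion.1 h
          rcases lt_or_ge n N with h' | h'
          · exact Or.inr (Or.inr (mem_biUnion (show n ∈ Iio N from h') hn))
          · exact Or.inr (Or.inl (disjoint_left.1 hUW (hNU n h' ⟨hx, hn⟩))))
      ⟨y, hy.1, hy, hyt⟩
      ⟨v, hvK, Or.inl (disjoint_left.1 hUW (hPU ⟨⟨hvK, hv⟩, hvt⟩))⟩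
    rcases hx with hx | hx
    · exact hx (hRW hxR)
    · simp only [mem_iUnion, exists_prop] at hx
      obtain ⟨n, -, hxn⟩ := hx
      have hxv : x ∈ A n ∩ F := ⟨hxn, hxR.1.2⟩
      rw [hAF n, mem_singleton_iff] at hxv
      subst hxv
      exact hemp ⟨x, hxR.1, hvt, hxR.2⟩
  rw [isPreconnected_closed_iff]
  intro t t' ht ht' hs hn hn'
  rcases hs ⟨hvK, hv⟩ with h | h
  · exact key t t' ht ht' hs hn' h
  · rw [inter_comm t t']
    exact key t' t ht' ht (union_comm t t' ▸ hs) hn h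

lemma unicoherentOn_union_iUnion [T2Space X] (hv : v ∈ F) (hF : IsClosed F)
    (hA : ∀ n, IsClosed (A n))
    (hdisj : ∀ m n, m ≠ n → A m ∩ A n = {v}) (hAF : ∀ n, A n ∩ F = {v})
    (hlim : {x : X | ∀ U ∈ 𝓝 x, ∀ N : ℕ, ∃ n, N ≤ n ∧ (U ∩ A n).Nonempty} ⊆ F)
    (hFu : UnicoherentOn F) (hAu : ∀ n, UnicoherentOn (A n)) :
    UnicoherentOn (F ∪ ⋃ n, A n) := by
  have hvA : ∀ n, v ∈ A n := fun n => (hAF n ▸ mem_singleton v : v ∈ A n ∩ F).1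
  have interF : ∀ P R : Set X, P ⊆ F ∪ ⋃ n, A n → R ⊆ F ∪ ⋃ n, A n → IsCompact P →
      IsCompact R → IsPreconnected P → IsPreconnected R → ((P ∩ F) ∩ (R ∩ F)).Nonempty →
      IsPreconnected ((P ∩ F) ∩ (R ∩ F)) := fun P R hP hR hPc hRc hPp hRp hne =>
    hFu _ _ inter_subset_right inter_subset_right (hPc.inter_right hF) (hRc.inter_right hF)
      (hPp.inter_base hv hF hA hdisj hAF hlim hPc hP)
      (hRp.inter_base hv hF hA hdisj hAF hlim hRc hR) hne
  have interA : ∀ n, ∀ P R : Set X, P ⊆ F ∪ ⋃ n, A n → R ⊆ F ∪ ⋃ n, A n → IsCompact P →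
      IsCompact R → IsPreconnected P → IsPreconnected R → ((P ∩ A n) ∩ (R ∩ A n)).Nonempty →
      IsPreconnected ((P ∩ A n) ∩ (R ∩ A n)) := fun n P R hP hR hPc hRc hPp hRp hne =>
    hAu n _ _ inter_subset_right inter_subset_right (hPc.inter_right (hA n))
      (hRc.inter_right (hA n)) (hPp.inter_attached hv hF hA hdisj hAF hlim hP n)
      (hRp.inter_attached hv hF hA hdisj hAF hlim hR n) hne
  have avoid : ∀ P R : Set X, P ⊆ F ∪ ⋃ n, A n → R ⊆ F ∪ ⋃ n, A n → IsCompact P →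
      IsCompact R → IsPreconnected P → IsPreconnected R → (P ∩ R).Nonempty → v ∉ P →
      IsPreconnected (P ∩ R) := by
    intro P R hP hR hPc hRc hPp hRp hne hvP
    have eq : ∀ S, P ⊆ S → P ∩ R = (P ∩ S) ∩ (R ∩ S) := fun S hS => by
      rw [← inter_inter_distrib_right]
      exact (inter_eq_left.2 (inter_subset_left.trans hS)).symm
    rcases hPp.subset_piece hv hF hA hdisj hAF hlim hP hvP with h | ⟨n, h⟩
    · rw [eq F h] at hne ⊢
      exact interF P R hP hR hPc hRc hPp hRp hne
    · rw [eq (A n) h] at hne ⊢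
      exact interA n P R hP hR hPc hRc hPp hRp hne
  intro P R hP hR hPc hRc hPp hRp hne
  by_cases hvP : v ∈ P
  swap
  · exact avoid P R hP hR hPc hRc hPp hRp hne hvP
  by_cases hvR : v ∈ R
  swap
  · rw [inter_comm] at hne ⊢
    exact avoid R P hR hP hRc hPc hRp hPp hne hvR
  refine isPreconnected_of_forall v fun y hy => ?_
  have hsubset : ∀ S, (P ∩ S) ∩ (R ∩ S) ⊆ P ∩ R := fun S =>
    inter_subset_inter inter_subset_left inter_subset_left
  rcases hP hy.1 with h | h
  · exact ⟨_, hsubset F, ⟨⟨hvP, hv⟩, hvR, hv⟩, ⟨⟨hy.1, h⟩, hy.2, h⟩,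
      interF P R hP hR hPc hRc hPp hRp ⟨v, ⟨hvP, hv⟩, hvR, hv⟩⟩
  · obtain ⟨n, hn⟩ := mem_iUnion.1 h
    exact ⟨_, hsubset (A n), ⟨⟨hvP, hvA n⟩, hvR, hvA n⟩, ⟨⟨hy.1, hn⟩, hy.2, hn⟩,
      interA n P R hP hR hPc hRc hPp hRp ⟨v, ⟨hvP, hvA n⟩, hvR, hvA n⟩⟩

end Attaching

/-- If `F` is a fan in the Hilbert cube with top `v` and `(Aₙ)` is a sequence of arcs,
each with end-point `v`, pairwise intersecting in `{v}`, each meeting `F` exactly in `{v}`,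
and with `limsup Aₙ ⊆ F`, then `F ∪ ⋃ₙ Aₙ` is a fan. -/
theorem statement4 (F : Set HilbertCube) (v : HilbertCube) (hv : v ∈ F)
    (hF : IsFan ↥F) (hvtop : IsFanTop (⟨v, hv⟩ : F))
    (A : ℕ → Set HilbertCube)
    (hArc : ∀ n, IsArc (A n))
    (hend : ∀ n, IsArcEndpoint (A n) v)
    (hdisj : ∀ m n, m ≠ n → A m ∩ A n = {v})
    (hAF : ∀ n, A n ∩ F = {v})
    (hlimsup : {x : HilbertCube | ∀ U ∈ nhds x, ∀ N : ℕ, ∃ n, N ≤ n ∧ (U ∩ A n).Nonempty} ⊆ F) :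
    IsFan ↥(F ∪ ⋃ n, A n) := by
  obtain ⟨⟨⟨-, -, -, -, hFarc, hFu⟩, hFram⟩, hFcl⟩ : IsFan F ∧ IsClosed F := by
    have := hF.1.2.1
    exact ⟨hF, (isCompact_iff_compactSpace.2 this).isClosed⟩
  have hAcl : ∀ n, IsClosed (A n) := fun n => (hArc n).isCompact.isClosed
  have hcl : IsClosed (F ∪ ⋃ n, A n) := by
    simpa using isClosed_union_biUnion hFcl hAcl hlimsup univ
  have hFj : ∀ x ∈ F, ∀ y ∈ F, x ≠ y → ArcJoinedIn F x y := by
    intro x hx y hy hxy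
    obtain ⟨B, hBx, hBy⟩ := hFarc ⟨x, hx⟩ ⟨y, hy⟩ fun h => hxy (congrArg Subtype.val h)
    exact (hBx.isArc.arcJoinedIn hBx.mem hBy.mem fun h => hxy (congrArg Subtype.val h)).map
      continuous_subtype_val Subtype.val_injective fun z _ => z.2
  have hFuo : UnicoherentOn F := by
    simpa using hFu.unicoherentOn_univ.range IsEmbedding.subtypeVal
  have hjoin : ∀ x y : ↥(F ∪ ⋃ n, A n), x ≠ y → ArcJoinedIn univ x y := by
    intro x y hxy
    obtain ⟨γ, hγ, hmem⟩ := arcJoinedIn_union_iUnion hv hdisj hAF hFj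
      (fun n x hx y hy hne => (hArc n).arcJoinedIn hx hy hne) x.2 y.2
      (fun h => hxy (Subtype.ext h))
    exact ⟨⟨⟨fun t => ⟨γ t, hmem t⟩, by fun_prop⟩, Subtype.ext γ.source, Subtype.ext γ.target⟩,
      fun s t h => hγ (congrArg Subtype.val h), fun _ => mem_univ _⟩
  have hne : Nonempty ↥(F ∪ ⋃ n, A n) := ⟨⟨v, Or.inl hv⟩⟩
  have hpc : PathConnectedSpace ↥(F ∪ ⋃ n, A n) := by
    refine ⟨hne, fun x y => ?_⟩
    by_cases hxy : x = y
    · exact hxy ▸ Joined.refl x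
    · exact ⟨(hjoin x y hxy).choose⟩
  have hram : ∀ x : ↥(F ∪ ⋃ n, A n), IsRamificationPoint x → x = ⟨v, Or.inl hv⟩ := by
    intro x hx
    by_contra hxv
    obtain ⟨φ, hφ, hinj, -, hφv⟩ := hx.exists_avoiding hxv
    have hψ : Continuous fun p => (φ p : HilbertCube) := continuous_subtype_val.comp hφ
    have hψi : Function.Injective fun p => (φ p : HilbertCube) := Subtype.val_injective.comp hinj
    have := isPreconnected_iff_preconnectedSpace.1 isPreconnected_TSet
    rcases (isPreconnected_range hψ).subset_piece hv hFcl hAcl hdisj hAF hlimsup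
      (range_subset_iff.2 fun p => (φ p).2)
      (by rintro ⟨p, hp⟩; exact hφv p (Subtype.ext hp)) with h | ⟨n, h⟩
    · rw [range_subset_iff] at h
      have hr := isRamificationPoint_of_injective (φ := fun p => (⟨φ p, h p⟩ : F))
        (hψ.subtype_mk h) fun p q hpq => hψi (congrArg (Subtype.val : F → HilbertCube) hpq)
      rcases hvtop with hvr | ⟨hno, -⟩
      · exact hφv _ (Subtype.ext (congrArg (Subtype.val : F → HilbertCube)
          (hFram _ _ hr hvr)))
      · exact hno _ hr
    · rw [range_subset_iff] at h
      obtain ⟨e⟩ := hArc n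
      refine not_injective_TSet_real (fun p => (e.symm ⟨φ p, h p⟩ : ℝ)) ?_ ?_
      · exact continuous_subtype_val.comp (e.symm.continuous.comp (hψ.subtype_mk h))
      · intro p q hpq
        exact hψi (congrArg (Subtype.val : A n → HilbertCube)
          (e.symm.injective (Subtype.ext hpq)))
  refine ⟨⟨hne, isCompact_iff_compactSpace.1 hcl.isCompact, inferInstance, inferInstance,
    fun x y hxy => (hjoin x y hxy).exists_arc, ?_⟩, fun x y hx hy => (hram x hx).trans
    (hram y hy).symm⟩
  refine UnicoherentOn.hereditarilyUnicoherent (.of_range IsEmbedding.subtypeVal ?_)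
  rw [Subtype.range_coe]
  exact unicoherentOn_union_iUnion hv hFcl hAcl hdisj hAF hlimsup hFuo
    fun n => (hArc n).unicoherentOn
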